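/- arXiv:math/9808136 — 2 statements merged into one kernel-verified Lean document; each statement's English description precedes it below -/
import Mathlib

section
/- Distinct norm-2 representatives of Leech lattice points are far apart: if r, s ∈ II_{25,1} satisfy B(r,ρ) = B(s,ρ) = −1, B(r,r) = B(s,s) = 2, and r ≠ s, then B(r − s, r − s) ≥ 4. (This expresses that the Leech lattice, realized isometrically as {r ∈ II_{25,1} : B(r,ρ) = −1, r² = 2}, has minimal nonzero norm 4, i.e. contains no roots.) -/
noncomputable section

/-- The Lorentzian bilinear form on ℝ^26: coordinates 0,…,24 are spacelike,
coordinate 25 (the "x₀" coordinate) is timelike. -/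
def B (x y : Fin 26 → ℝ) : ℝ :=
  (∑ i : Fin 25, x i.castSucc * y i.castSucc) - x (Fin.last 25) * y (Fin.last 25)

/-- The vector w = (1/2, …, 1/2; 1/2). -/
def w : Fin 26 → ℝ := fun _ => 1/2

/-- The even self-dual Lorentzian lattice II₂₅,₁ : vectors all of whose coordinates are
integers, or all of whose coordinates are half odd integers, having integral inner
product with w. -/
def II : Set (Fin 26 → ℝ) :=
  {x | ((∀ i, ∃ m : ℤ, x i = m) ∨ (∀ i, ∃ m : ℤ, x i = m + 1/2)) ∧ ∃ k : ℤ, B x w = k}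

/-- The Weyl vector ρ = (0,1,2,…,24;70). -/
def ρ : Fin 26 → ℝ := fun i => if (i : ℕ) < 25 then ((i : ℕ) : ℝ) else 70

namespace LeechMinNorm

open Finset

/-- The integer congruent to `e` modulo `2` that is closest to `p * i / q`. -/
def nearest (p q e i : ℤ) : ℤ := 2 * ((p * i - e * q + q) / (2 * q)) + e

/-- The quadratic cost `q * x ^ 2 - 2 * p * i * x`, minimal on the reals at `p * i / q`. -/
def cost (p q i x : ℤ) : ℤ := q * x ^ 2 - 2 * p * i * x

/-- The increase of `cost p q i` from `nearest p q e i` to `nearest p q e i + 2 * k`. -/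
def excess (p q e i k : ℤ) : ℤ := 4 * k * (q * k + (q * nearest p q e i - p * i))

/-- Branch-and-bound search for integers `a 0, …, a (N - 1)` congruent to `e` modulo `2`, with
total excess `s` and `∑ i, i * a i = c`. -/
def search (p q e : ℤ) : ℕ → ℤ → ℤ → Bool
  | 0, s, c => decide (s = 0) && decide (c = 0)
  | i + 1, s, c => decide (0 ≤ s) && [-2, -1, 0, 1, 2].any fun k : ℤ =>
      search p q e i (s - excess p q e i k) (c - i * (nearest p q e i + 2 * k))

lemma abs_mul_nearest_sub_le {q : ℤ} (hq : 0 < q) (p e i : ℤ) :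
    |q * nearest p q e i - p * i| ≤ q := by
  have h1 := Int.emod_add_mul_ediv (p * i - e * q + q) (2 * q)
  have h2 := Int.emod_nonneg (p * i - e * q + q) (by lia : 2 * q ≠ 0)
  have h3 := Int.emod_lt_of_pos (p * i - e * q + q) (by lia : 0 < 2 * q)
  unfold nearest
  rw [abs_le]
  constructor <;> linarith

lemma excess_lower_bound {q : ℤ} (hq : 0 < q) (p e i k : ℤ) :
    4 * q * (|k| * (|k| - 1)) ≤ excess p q e i k := by
  have h := abs_mul_nearest_sub_le hq p e i
  unfold excess
  generalize q * nearest p q e i - p * i = d at h ⊢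
  have h1 : -(|k| * q) ≤ k * d := by
    have := neg_abs_le (k * d)
    rw [abs_mul] at this
    linarith [mul_le_mul_of_nonneg_left h (abs_nonneg k)]
  linarith [congrArg (q * ·) (sq_abs k)]

lemma excess_nonneg {q : ℤ} (hq : 0 < q) (p e i k : ℤ) : 0 ≤ excess p q e i k := by
  refine le_trans (mul_nonneg (by lia) ?_) (excess_lower_bound hq p e i k)
  rcases (abs_nonneg k).eq_or_lt with h | h
  · simp [← h]
  · exact mul_nonneg h.le (by lia)

lemma abs_le_two_of_excess_lt {q : ℤ} (hq : 0 < q) {p e i k : ℤ}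
    (h : excess p q e i k < 24 * q) : |k| ≤ 2 := by
  by_contra! hk
  have h1 := excess_lower_bound hq p e i k
  have h2 : (6 : ℤ) ≤ |k| * (|k| - 1) := by nlinarith
  nlinarith

lemma search_eq_true {p q e : ℤ} (hq : 0 < q) (k : ℕ → ℤ) (N : ℕ) (s c : ℤ)
    (hs : ∑ i ∈ range N, excess p q e i (k i) = s)
    (hc : ∑ i ∈ range N, (i : ℤ) * (nearest p q e i + 2 * k i) = c) (hlt : s < 24 * q) :
    search p q e N s c = true := by
  induction N generalizing s c with
  | zero => simp_all [search]
  | succ N ih =>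
    rw [sum_range_succ] at hs hc
    have h0 : 0 ≤ ∑ i ∈ range N, excess p q e i (k i) :=
      sum_nonneg fun i _ => excess_nonneg hq p e i (k i)
    have h1 := excess_nonneg hq p e N (k N)
    have h2 := abs_le.1 (abs_le_two_of_excess_lt hq (by linarith : excess p q e N (k N) < 24 * q))
    have h3 := ih _ _ (eq_sub_of_add_eq hs) (eq_sub_of_add_eq hc) (by linarith)
    have h4 : k N ∈ [-2, -1, 0, 1, 2] := by
      simp only [List.mem_cons, List.not_mem_nil, or_false]
      lia
    rw [search, Bool.and_eq_true, decide_eq_true_eq, List.any_eq_true]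
    exact ⟨by linarith, k N, h4, h3⟩

/-- The total excess of a vector with `∑ i, a i ^ 2 = 8 + T ^ 2` and `∑ i, i * a i = 70 * T`. -/
def totalExcess (p q T : ℤ) : ℤ :=
  q * (8 + T ^ 2) - 140 * p * T - ∑ i ∈ range 25, cost p q i (nearest p q (T % 2) i)

/-- Slopes `p / q` such that the search for a vector of height `T` fails, for `0 ≤ T ≤ 70`. -/
def slopes : List (ℤ × ℤ) :=
  [(0, 1), (0, 1), (1, 21), (0, 1), (1, 14), (1, 12), (1, 13), (1, 9), (1, 8),
   (1, 8), (1, 7), (1, 6), (1, 6), (2, 11), (5, 24), (3, 14), (2, 9), (1, 4),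
   (1, 4), (3, 11), (5, 17), (3, 10), (4, 13), (1, 3), (1, 3), (4, 11), (3, 8),
   (5, 13), (9, 23), (5, 12), (3, 7), (4, 9), (5, 11), (7, 15), (11, 23), (1, 2),
   (1, 2), (8, 15), (6, 11), (5, 9), (13, 23), (7, 12), (3, 5), (8, 13), (5, 8),
   (7, 11), (13, 20), (2, 3), (11, 16), (7, 10), (5, 7), (8, 11), (17, 23), (3, 4),
   (17, 22), (7, 9), (19, 24), (9, 11), (19, 23), (5, 6), (19, 22), (7, 8), (15, 17),
   (9, 10), (21, 23), (11, 12), (16, 17), (18, 19), (1, 1), (1, 1), (1, 1)]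

lemma search_slopes_eq_false : ∀ T ∈ range 71, ∃ x ∈ slopes[T]?,
    0 < x.2 ∧ totalExcess x.1 x.2 T < 24 * x.2 ∧
      search x.1 x.2 ((T : ℤ) % 2) 25 (totalExcess x.1 x.2 T) (70 * T) = false := by
  decide +kernel

lemma no_root_of_height_le (T : ℕ) (hT : T ≤ 70) (a : ℕ → ℤ)
    (hpar : ∀ i, a i % 2 = (T : ℤ) % 2)
    (hnorm : ∑ i ∈ range 25, a i ^ 2 = 8 + (T : ℤ) ^ 2)
    (horth : ∑ i ∈ range 25, (i : ℤ) * a i = 70 * T) : False := by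
  obtain ⟨⟨p, q⟩, -, hq, hlt, hsearch⟩ := search_slopes_eq_false T (by simp; lia)
  dsimp only at hq hlt hsearch
  have hk : ∀ i : ℕ, ∃ k, a i = nearest p q ((T : ℤ) % 2) i + 2 * k := fun i =>
    ⟨(a i - nearest p q ((T : ℤ) % 2) i) / 2, by have := hpar i; unfold nearest; lia⟩
  choose k hk using hk
  refine absurd (search_eq_true hq k 25 _ _ ?_ ?_ hlt) (by rw [hsearch]; simp)
  · have h : ∀ i : ℕ, excess p q ((T : ℤ) % 2) i (k i) =
        q * a i ^ 2 - 2 * p * (i * a i) - cost p q i (nearest p q ((T : ℤ) % 2) i) := by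
      intro i
      rw [hk i, excess, cost]
      ring
    simp only [h, sum_sub_distrib, ← mul_sum, hnorm, horth, totalExcess]
    ring
  · simp only [← hk, horth]

/-- In doubled coordinates: there is no vector of norm `2` orthogonal to the Weyl vector. -/
lemma no_root (T : ℤ) (a : ℕ → ℤ) (hpar : ∀ i, a i % 2 = T % 2)
    (hnorm : ∑ i ∈ range 25, a i ^ 2 = 8 + T ^ 2)
    (horth : ∑ i ∈ range 25, (i : ℤ) * a i = 70 * T) : False := by
  have hsq : ∑ i ∈ range 25, (i : ℤ) ^ 2 = 4900 := by decide +kernel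
  -- Translate by multiples of the Weyl vector, and negate if necessary.
  obtain ⟨k, hk⟩ : ∃ k, |T - 140 * k| ≤ 70 := ⟨(T + 70) / 140, by rw [abs_le]; lia⟩
  obtain ⟨u, hu, hTu⟩ : ∃ u : ℤ, u ^ 2 = 1 ∧ |T - 140 * k| = u * (T - 140 * k) := by
    rcases abs_choice (T - 140 * k) with h | h
    · exact ⟨1, by simp, by simpa using h⟩
    · exact ⟨-1, by simp, by simpa using h⟩
  have hcast : ((T - 140 * k).natAbs : ℤ) = u * (T - 140 * k) := by
    rw [Int.natCast_natAbs, hTu]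
  refine no_root_of_height_le (T - 140 * k).natAbs (by lia) (fun i => u * (a i - 2 * k * i))
    (fun i => ?_) ?_ ?_
  · rw [hcast]
    have := hpar i
    exact Int.ModEq.mul_left u (show (a i - 2 * k * i) % 2 = _ by
      rw [mul_assoc]; generalize k * (i : ℤ) = m; lia)
  · have h : ∀ i : ℕ, (u * (a i - 2 * k * i)) ^ 2 =
        a i ^ 2 - 4 * k * (i * a i) + 4 * k ^ 2 * (i : ℤ) ^ 2 := fun i => by
      rw [mul_pow, hu]; ring
    simp only [h, sum_add_distrib, sum_sub_distrib, ← mul_sum, hnorm, horth, hsq, hcast]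
    rw [mul_pow, hu]
    ring
  · have h : ∀ i : ℕ, (i : ℤ) * (u * (a i - 2 * k * i)) =
        u * (i * a i) - 2 * u * k * (i : ℤ) ^ 2 := fun i => by ring
    simp only [h, sum_sub_distrib, ← mul_sum, horth, hsq, hcast]
    ring

lemma B_sub_left (x y z : Fin 26 → ℝ) : B (x - y) z = B x z - B y z := by
  simp only [B, Pi.sub_apply, sub_mul, sum_sub_distrib]
  ring

lemma B_ρ (x : Fin 26 → ℝ) :
    B x ρ = ∑ i : Fin 25, (i : ℕ) * x i.castSucc - 70 * x (Fin.last 25) := by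
  simp [B, ρ, mul_comm]

lemma sum_sq_val : ∑ i : Fin 25, ((i : ℕ) : ℝ) ^ 2 = 4900 := by
  rw [Fin.sum_univ_eq_sum_range (fun i => (i : ℝ) ^ 2) 25]
  norm_num [sum_range_succ]

/-- On `ρ⊥` the form is a sum of squares. -/
lemma B_self_eq_sum_sq {z : Fin 26 → ℝ} (hz : B z ρ = 0) :
    B z z = ∑ i : Fin 25, (z i.castSucc - z (Fin.last 25) / 70 * (i : ℕ)) ^ 2 := by
  rw [B_ρ] at hz
  have h : ∀ i : Fin 25, (z i.castSucc - z (Fin.last 25) / 70 * (i : ℕ)) ^ 2 =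
      z i.castSucc * z i.castSucc - z (Fin.last 25) / 35 * ((i : ℕ) * z i.castSucc) +
        (z (Fin.last 25) / 70) ^ 2 * ((i : ℕ) : ℝ) ^ 2 := fun i => by ring
  simp only [h, sum_add_distrib, sum_sub_distrib, ← mul_sum, sum_sq_val, B]
  linear_combination z (Fin.last 25) / 35 * hz

lemma B_self_nonneg {z : Fin 26 → ℝ} (hz : B z ρ = 0) : 0 ≤ B z z := by
  rw [B_self_eq_sum_sq hz]
  positivity

lemma eq_smul_ρ_of_B_self_eq_zero {z : Fin 26 → ℝ} (hz : B z ρ = 0) (h0 : B z z = 0) :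
    z = (z (Fin.last 25) / 70) • ρ := by
  rw [B_self_eq_sum_sq hz, sum_eq_zero_iff_of_nonneg fun _ _ => sq_nonneg _] at h0
  funext i
  induction i using Fin.lastCases with
  | last => simp [ρ]
  | cast i => simpa [ρ] using sub_eq_zero.1 (pow_eq_zero_iff two_ne_zero |>.1 (h0 i (mem_univ i)))

lemma B_self_add_smul_ρ (s : Fin 26 → ℝ) (c : ℝ) :
    B (s + c • ρ) (s + c • ρ) = B s s + 2 * c * B s ρ := by
  have hρ : B ρ ρ = 0 := by
    rw [B_ρ]
    have h := sum_sq_val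
    simp only [ρ, Fin.val_castSucc, Fin.is_lt, if_true, Fin.val_last, lt_irrefl, if_false, ← sq, h]
    norm_num
  have h : B (s + c • ρ) (s + c • ρ) = B s s + 2 * c * B s ρ + c ^ 2 * B ρ ρ := by
    have h : ∀ i, (s + c • ρ) i * (s + c • ρ) i =
        s i * s i + 2 * c * (s i * ρ i) + c ^ 2 * (ρ i * ρ i) := fun i => by
      simp only [Pi.add_apply, Pi.smul_apply, smul_eq_mul]; ring
    simp only [B, h, sum_add_distrib, ← mul_sum]
    ring
  rw [h, hρ]
  ring

lemma sub_mem_II {x y : Fin 26 → ℝ} (hx : x ∈ II) (hy : y ∈ II) : x - y ∈ II := by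
  obtain ⟨hx, k, hk⟩ := hx
  obtain ⟨hy, l, hl⟩ := hy
  refine ⟨?_, k - l, by rw [B_sub_left, hk, hl]; push_cast; ring⟩
  rcases hx with hx | hx <;> rcases hy with hy | hy <;> choose m hm using hx <;>
    choose n hn using hy
  · exact .inl fun i => ⟨m i - n i, by simp [hm, hn]⟩
  · exact .inr fun i => ⟨m i - n i - 1, by simp [hm, hn]; ring⟩
  · exact .inr fun i => ⟨m i - n i, by simp [hm, hn]; ring⟩
  · exact .inl fun i => ⟨m i - n i, by simp [hm, hn]⟩

/-- The doubled coordinates of a vector of `II` are integers of the same parity. -/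
lemma exists_double_of_mem_II {z : Fin 26 → ℝ} (hz : z ∈ II) :
    ∃ a : Fin 26 → ℤ, (∀ i, 2 * z i = a i) ∧ ∀ i j, a i % 2 = a j % 2 := by
  rcases hz.1 with h | h <;> choose m hm using h
  · exact ⟨fun i => 2 * m i, fun i => by simp [hm], fun i j => by lia⟩
  · exact ⟨fun i => 2 * m i + 1, fun i => by rw [hm]; push_cast; ring, fun i j => by lia⟩

/-- The lattice `II` is even. -/
lemma exists_B_self_eq_two_mul {z : Fin 26 → ℝ} (hz : z ∈ II) : ∃ n : ℤ, B z z = 2 * n := by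
  obtain ⟨hz, k, hk⟩ := hz
  simp only [B, w, ← sum_mul] at hk
  rcases hz with h | h <;> choose m hm using h <;> simp only [hm, sum_add_distrib] at hk
  · have hd : ∀ n : ℤ, n * n = n + 2 * (n * (n - 1) / 2) := fun n => by
      rw [Int.mul_ediv_cancel' (Int.even_mul_pred_self n).two_dvd]; ring
    have hd' : ∀ n : ℤ, (n : ℝ) * n = n + 2 * ((n * (n - 1) / 2 : ℤ) : ℝ) := fun n => by
      exact_mod_cast hd n
    refine ⟨k + ∑ i : Fin 25, m i.castSucc * (m i.castSucc - 1) / 2 -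
      m (Fin.last 25) * (m (Fin.last 25) - 1) / 2, ?_⟩
    simp only [B, hm, hd', sum_add_distrib, ← mul_sum]
    rw [Int.cast_sub, Int.cast_add, Int.cast_sum]
    linear_combination 2 * hk
  · have hd : ∀ n : ℤ, n * (n + 1) = 2 * (n * (n + 1) / 2) := fun n => by
      rw [Int.mul_ediv_cancel' (Int.even_mul_succ_self n).two_dvd]
    have hd' : ∀ n : ℤ, ((n : ℝ) + 1 / 2) * (n + 1 / 2) =
        2 * ((n * (n + 1) / 2 : ℤ) : ℝ) + 1 / 4 := fun n => by
      have : (n : ℝ) * (n + 1) = 2 * ((n * (n + 1) / 2 : ℤ) : ℝ) := by exact_mod_cast hd n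
      linear_combination this
    refine ⟨∑ i : Fin 25, m i.castSucc * (m i.castSucc + 1) / 2 -
      m (Fin.last 25) * (m (Fin.last 25) + 1) / 2 + 3, ?_⟩
    simp only [B, hm, hd', sum_add_distrib, ← mul_sum, sum_const, card_univ, Fintype.card_fin]
    push_cast
    ring

/-- No vector of `II` orthogonal to the Weyl vector has norm `2`. -/
lemma B_self_ne_two {z : Fin 26 → ℝ} (hz : z ∈ II) (hzρ : B z ρ = 0) : B z z ≠ 2 := by
  intro h2
  obtain ⟨a, ha, hpar⟩ := exists_double_of_mem_II hz
  have hz' : ∀ i, z i = a i / 2 := fun i => by linarith [ha i]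
  rw [B_ρ] at hzρ
  simp only [B] at h2
  simp only [hz'] at hzρ h2
  have hnorm : ∑ i : Fin 25, a i.castSucc ^ 2 = 8 + a (Fin.last 25) ^ 2 := by
    have h : ∑ i : Fin 25, (a i.castSucc : ℝ) ^ 2 = 8 + (a (Fin.last 25) : ℝ) ^ 2 := by
      have h (i : Fin 25) : (a i.castSucc : ℝ) / 2 * (a i.castSucc / 2) =
        1 / 4 * (a i.castSucc : ℝ) ^ 2 := by ring
      simp only [h, ← mul_sum] at h2
      linear_combination 4 * h2
    exact_mod_cast h
  have horth : ∑ i : Fin 25, ((i : ℕ) : ℤ) * a i.castSucc = 70 * a (Fin.last 25) := by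
    have h : ∑ i : Fin 25, ((i : ℕ) : ℝ) * (a i.castSucc : ℝ) = 70 * (a (Fin.last 25) : ℝ) := by
      simp only [← mul_div_assoc, ← sum_div] at hzρ
      linear_combination 2 * hzρ
    exact_mod_cast h
  refine no_root (a (Fin.last 25)) (fun i => a (Fin.ofNat 26 i)) (fun i => hpar _ _) ?_ ?_
  · rw [← Fin.sum_univ_eq_sum_range (fun i => a (Fin.ofNat 26 i) ^ 2) 25, ← hnorm]
    refine sum_congr rfl fun i _ => ?_
    congr 2
    ext
    simp
  · rw [← Fin.sum_univ_eq_sum_range (fun i => (i : ℤ) * a (Fin.ofNat 26 i)) 25, ← horth]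
    refine sum_congr rfl fun i _ => ?_
    congr 2
    ext
    simp

end LeechMinNorm

/-- Distinct norm-2 representatives of Leech lattice points are far apart: the Leech
lattice {r ∈ II₂₅,₁ : B(r,ρ) = −1, r² = 2} has minimal nonzero norm 4. -/
theorem leech_min_norm_four (r s : Fin 26 → ℝ)
    (hr : r ∈ II) (hs : s ∈ II)
    (hrρ : B r ρ = -1) (hsρ : B s ρ = -1)
    (hr2 : B r r = 2) (hs2 : B s s = 2)
    (hrs : r ≠ s) :
    B (r - s) (r - s) ≥ 4 := by
  have hzρ : B (r - s) ρ = 0 := by rw [LeechMinNorm.B_sub_left, hrρ, hsρ, sub_self]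
  have hz := LeechMinNorm.sub_mem_II hr hs
  obtain ⟨n, hn⟩ := LeechMinNorm.exists_B_self_eq_two_mul hz
  have hnonneg := LeechMinNorm.B_self_nonneg hzρ
  have hne_two := LeechMinNorm.B_self_ne_two hz hzρ
  have hne_zero : B (r - s) (r - s) ≠ 0 := by
    intro h0
    have h := LeechMinNorm.eq_smul_ρ_of_B_self_eq_zero hzρ h0
    generalize (r - s) (Fin.last 25) / 70 = c at h
    have hrc : r = s + c • ρ := by rw [← h]; abel
    have hc := LeechMinNorm.B_self_add_smul_ρ s c
    rw [← hrc, hr2, hs2, hsρ] at hc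
    obtain rfl : c = 0 := by linarith
    exact hrs (by simpa using hrc)
  rw [hn] at hnonneg hne_two hne_zero ⊢
  have h0 : 0 ≤ n := by exact_mod_cast (by linarith : (0 : ℝ) ≤ n)
  have h1 : n ≠ 0 := by rintro rfl; simp at hne_zero
  have h2 : n ≠ 1 := by rintro rfl; simp at hne_two
  have h3 : (2 : ℝ) ≤ n := by exact_mod_cast (by lia : 2 ≤ n)
  linarith
end
end

section
/- The inner products of the simple roots labelled by the Leech lattice form a symmetrizable generalized Cartan datum in the sense of conditions (km1)–(km4): for r, s in the set S = {r ∈ II_{25,1} : B(r,ρ) = −1, B(r,r) = 2} with r ≠ s, one has B(r,r) = 2 > 0, B(r,s) = B(s,r), B(r,s) ∈ ℤ, and B(r,s) ≤ 0. -/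
noncomputable section

/-- The least value of `z ^ 2` over the integers `z` congruent to `c` modulo `140`. -/
def minSq (c : ℤ) : ℤ := min ((c % 140) ^ 2) ((c % 140 - 140) ^ 2)

/-- A lower bound for `∑ j < n, (z j) ^ 2` when `z j ≡ (70 - j) * k` modulo `140`. -/
def minSqSum (k : ℤ) : ℕ → ℤ
  | 0 => 0
  | n + 1 => minSqSum k n + minSq ((70 - n) * k)

/-- The sum of the squares of the natural numbers below `n`. -/
def sumSq : ℕ → ℤ
  | 0 => 0
  | n + 1 => sumSq n + (n : ℤ) ^ 2

/-- A pruned exhaustive search; if it returns `true` there are no integers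
`z j ≡ (70 - j) * k` modulo `140`, for `j < n`, with `∑ (z j) ^ 2 = R` and `S + ∑ j * z j = 0`. -/
def noSolution (k : ℤ) : ℕ → ℤ → ℤ → Bool
  | 0, R, S => !(decide (R = 0) && decide (S = 0))
  | n + 1, R, S =>
    decide (R < minSqSum k (n + 1)) || (decide (R * sumSq (n + 1) < S ^ 2) ||
      (noSolution k n (R - (((70 - n) * k) % 140 - 280) ^ 2)
          (S + n * (((70 - n) * k) % 140 - 280)) &&
        (noSolution k n (R - (((70 - n) * k) % 140 - 140) ^ 2)
          (S + n * (((70 - n) * k) % 140 - 140)) &&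
        (noSolution k n (R - (((70 - n) * k) % 140) ^ 2)
          (S + n * (((70 - n) * k) % 140)) &&
        noSolution k n (R - (((70 - n) * k) % 140 + 140) ^ 2)
          (S + n * (((70 - n) * k) % 140 + 140))))))

lemma minSq_le (c m : ℤ) : minSq c ≤ (140 * m + c) ^ 2 := by
  have h0 := Int.emod_nonneg c (by norm_num : (140 : ℤ) ≠ 0)
  have h1 := Int.emod_lt_of_pos c (by norm_num : (0 : ℤ) < 140)
  have h2 := Int.emod_add_mul_ediv c 140
  unfold minSq
  generalize c % 140 = d at *
  rcases le_or_gt 0 (m + c / 140) with h | h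
  · exact (min_le_left _ _).trans (by nlinarith)
  · exact (min_le_right _ _).trans (by nlinarith)

lemma minSqSum_le (k : ℤ) (m : ℕ → ℤ) (n : ℕ) :
    minSqSum k n ≤ ∑ j ∈ Finset.range n, (140 * m j + (70 - j) * k) ^ 2 := by
  induction n with
  | zero => simp [minSqSum]
  | succ n ih =>
    rw [Finset.sum_range_succ, minSqSum]
    exact add_le_add ih (minSq_le _ _)

lemma sumSq_eq (n : ℕ) : sumSq n = ∑ j ∈ Finset.range n, (j : ℤ) ^ 2 := by
  induction n with
  | zero => simp [sumSq]
  | succ n ih => rw [Finset.sum_range_succ, sumSq, ih]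

lemma eq_residue_of_sq_le {c m : ℤ} (h : (140 * m + c) ^ 2 ≤ 39200) :
    140 * m + c = c % 140 - 280 ∨ 140 * m + c = c % 140 - 140 ∨
      140 * m + c = c % 140 ∨ 140 * m + c = c % 140 + 140 := by
  have h1 : 140 * m + c ≤ 198 := by nlinarith
  have h2 : -198 ≤ 140 * m + c := by nlinarith
  omega

lemma noSolution_sound (k : ℤ) (m : ℕ → ℤ) (n : ℕ) (R S : ℤ) (hR : R ≤ 39200)
    (hn : noSolution k n R S = true)
    (hsq : ∑ j ∈ Finset.range n, (140 * m j + (70 - j) * k) ^ 2 = R)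
    (hlin : S + ∑ j ∈ Finset.range n, (j : ℤ) * (140 * m j + (70 - j) * k) = 0) : False := by
  induction n generalizing R S with
  | zero =>
    simp only [Finset.range_zero, Finset.sum_empty, add_zero] at hsq hlin
    simp [noSolution, ← hsq, hlin] at hn
  | succ n ih =>
    rw [noSolution, Bool.or_eq_true, Bool.or_eq_true, decide_eq_true_eq, decide_eq_true_eq] at hn
    rcases hn with hn | hn | hn
    · have := minSqSum_le k m (n + 1)
      omega
    · have := Finset.sum_mul_sq_le_sq_mul_sq (Finset.range (n + 1)) (fun j => (j : ℤ))
        (fun j => 140 * m j + (70 - j) * k)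
      rw [hsq, ← sumSq_eq, eq_neg_of_add_eq_zero_right hlin] at this
      linarith [neg_sq S, mul_comm R (sumSq (n + 1))]
    · rw [Finset.sum_range_succ] at hsq hlin
      simp only [Bool.and_eq_true] at hn
      obtain ⟨h1, h2, h3, h4⟩ := hn
      have hpos : 0 ≤ ∑ j ∈ Finset.range n, (140 * m j + (70 - j) * k) ^ 2 :=
        Finset.sum_nonneg fun _ _ => sq_nonneg _
      rcases eq_residue_of_sq_le (c := (70 - n) * k) (m := m n) (by linarith)
        with h | h | h | h <;> rw [h] at hsq hlin
      · exact ih _ _ (by nlinarith) h1 (by linarith) (by linarith)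
      · exact ih _ _ (by nlinarith) h2 (by linarith) (by linarith)
      · exact ih _ _ (by nlinarith) h3 (by linarith) (by linarith)
      · exact ih _ _ (by nlinarith) h4 (by linarith) (by linarith)

lemma noSolution_eq_true : ∀ k : Fin 140, noSolution (k : ℕ) 25 39200 0 = true := by
  decide +kernel

/-- The orthogonal complement of `(0, 1, …, 24; 70)` contains no vector of norm `2`, in terms of
the coordinates `140 * x j - 2 * j * x₀`. -/
lemma sum_sq_ne (k : ℤ) (m : ℕ → ℤ)
    (hlin : ∑ j ∈ Finset.range 25, (j : ℤ) * (140 * m j + (70 - j) * k) = 0) :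
    ∑ j ∈ Finset.range 25, (140 * m j + (70 - j) * k) ^ 2 ≠ 39200 := by
  intro hsq
  have h0 := Int.emod_nonneg k (by norm_num : (140 : ℤ) ≠ 0)
  have h1 := Int.emod_lt_of_pos k (by norm_num : (0 : ℤ) < 140)
  have h2 := Int.emod_add_mul_ediv k 140
  have hk := noSolution_eq_true ⟨(k % 140).toNat, by omega⟩
  simp only [Int.toNat_of_nonneg h0] at hk
  have key (j : ℕ) : 140 * m j + (70 - j) * k =
      140 * (m j + (70 - j) * (k / 140)) + (70 - j) * (k % 140) := by
    linear_combination -(70 - (j : ℤ)) * h2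
  simp only [key] at hsq hlin
  exact noSolution_sound _ (fun j => m j + (70 - j) * (k / 140)) 25 _ _ le_rfl hk hsq
    (by simpa using hlin)

lemma B_comm (x y : Fin 26 → ℝ) : B x y = B y x := by
  simp only [B, mul_comm]

lemma B_sub_left (x y z : Fin 26 → ℝ) : B (x - y) z = B x z - B y z := by
  simp only [B, Pi.sub_apply, sub_mul, Finset.sum_sub_distrib]
  ring

lemma B_ρ (x : Fin 26 → ℝ) :
    B x ρ = ∑ i : Fin 25, (i : ℝ) * x i.castSucc - 70 * x (Fin.last 25) := by
  simp [B, ρ, mul_comm]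

lemma sum_fin_sq : ∑ i : Fin 25, (i : ℝ) ^ 2 = 4900 := by
  rw [Fin.sum_univ_eq_sum_range (fun i => (i : ℝ) ^ 2)]
  norm_num [Finset.sum_range_succ]

/-- Coordinates of a vector of the lattice: all of them differ by integers from half an integer. -/
lemma exists_coords {x : Fin 26 → ℝ} (hx : x ∈ II) :
    ∃ (k : ℤ) (a : Fin 25 → ℤ) (c : ℤ), x (Fin.last 25) = k / 2 ∧
      (∀ i : Fin 25, x i.castSucc = k / 2 + a i) ∧ ∑ i, a i = 2 * c := by
  obtain ⟨hx, q, hq⟩ := hx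
  obtain ⟨k, a, hk, ha⟩ : ∃ (k : ℤ) (a : Fin 25 → ℤ), x (Fin.last 25) = k / 2 ∧
      ∀ i : Fin 25, x i.castSucc = k / 2 + a i := by
    rcases hx with hx | hx <;> choose f hf using hx
    · exact ⟨2 * f (Fin.last 25), fun i => f i.castSucc - f (Fin.last 25),
        by rw [hf]; push_cast; ring, fun i => by rw [hf]; push_cast; ring⟩
    · exact ⟨2 * f (Fin.last 25) + 1, fun i => f i.castSucc - f (Fin.last 25),
        by rw [hf]; push_cast; ring, fun i => by rw [hf]; push_cast; ring⟩
  refine ⟨k, a, q - 6 * k, hk, ha, ?_⟩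
  simp only [B, w, ha, hk, ← Finset.sum_mul, Finset.sum_add_distrib, Finset.sum_const,
    Finset.card_univ, Fintype.card_fin, nsmul_eq_mul] at hq
  have : ((∑ i, a i : ℤ) : ℝ) = (2 * (q - 6 * k) : ℤ) := by
    push_cast at hq ⊢
    linarith
  exact_mod_cast this

lemma B_integral {x y : Fin 26 → ℝ} (hx : x ∈ II) (hy : y ∈ II) : ∃ n : ℤ, B x y = n := by
  obtain ⟨k, a, c, hk, ha, hc⟩ := exists_coords hx
  obtain ⟨l, b, d, hl, hb, hd⟩ := exists_coords hy
  refine ⟨6 * k * l + k * d + l * c + ∑ i, a i * b i, ?_⟩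
  have hc' : ∑ i, (a i : ℝ) = 2 * c := by exact_mod_cast hc
  have hd' : ∑ i, (b i : ℝ) = 2 * d := by exact_mod_cast hd
  simp only [B, hk, ha, hl, hb, add_mul, mul_add, Finset.sum_add_distrib, ← Finset.mul_sum,
    ← Finset.sum_mul, hc', hd', Finset.sum_const, Finset.card_univ, Fintype.card_fin, nsmul_eq_mul]
  push_cast
  ring

/-- On the orthogonal complement of `ρ` the form is a sum of squares. -/
lemma sum_sq_eq {v : Fin 26 → ℝ} (hv : B v ρ = 0) :
    ∑ i : Fin 25, (140 * v i.castSucc - 2 * i * v (Fin.last 25)) ^ 2 = 19600 * B v v := by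
  rw [B_ρ] at hv
  have key (i : Fin 25) : (140 * v i.castSucc - 2 * i * v (Fin.last 25)) ^ 2 =
      19600 * (v i.castSucc * v i.castSucc) - 560 * v (Fin.last 25) * ((i : ℝ) * v i.castSucc)
        + 4 * v (Fin.last 25) ^ 2 * (i : ℝ) ^ 2 := by ring
  simp only [key, Finset.sum_add_distrib, Finset.sum_sub_distrib, ← Finset.mul_sum, sum_fin_sq, B]
  linear_combination (-560 * v (Fin.last 25)) * hv

lemma B_self_ne_two {r s : Fin 26 → ℝ} (hr : r ∈ II) (hs : s ∈ II) (hv : B (r - s) ρ = 0) :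
    B (r - s) (r - s) ≠ 2 := by
  intro h2
  obtain ⟨k, a, -, hk, ha, -⟩ := exists_coords hr
  obtain ⟨l, b, -, hl, hb, -⟩ := exists_coords hs
  let m : ℕ → ℤ := fun j => if h : j < 25 then a ⟨j, h⟩ - b ⟨j, h⟩ else 0
  have hm (i : Fin 25) : m i = a i - b i := by simp [m]
  have hz (i : Fin 25) : ((140 * m i + (70 - (i : ℕ)) * (k - l) : ℤ) : ℝ) =
      140 * (r - s) i.castSucc - 2 * i * (r - s) (Fin.last 25) := by
    simp only [hm, Pi.sub_apply, ha, hb, hk, hl]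
    push_cast
    ring
  have hsq := sum_sq_eq hv
  rw [h2] at hsq
  simp only [← hz] at hsq
  refine sum_sq_ne (k - l) m ?_ ?_
  · rw [← Fin.sum_univ_eq_sum_range (fun j => (j : ℤ) * (140 * m j + (70 - j) * (k - l)))]
    rw [← Int.cast_inj (α := ℝ), Int.cast_sum]
    simp only [Int.cast_mul (_ : ℤ) (140 * _ + _), hz]
    rw [B_ρ] at hv
    have key (i : Fin 25) :
        (((i : ℕ) : ℤ) : ℝ) * (140 * (r - s) i.castSucc - 2 * i * (r - s) (Fin.last 25)) =
        140 * ((i : ℝ) * (r - s) i.castSucc) - 2 * (r - s) (Fin.last 25) * (i : ℝ) ^ 2 := by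
      push_cast
      ring
    simp only [key, Finset.sum_sub_distrib, ← Finset.mul_sum, sum_fin_sq]
    rw [Int.cast_zero]
    linear_combination 140 * hv
  · rw [← Fin.sum_univ_eq_sum_range (fun j => (140 * m j + (70 - j) * (k - l)) ^ 2)]
    rw [← Int.cast_inj (α := ℝ), Int.cast_sum]
    simp only [Int.cast_pow]
    rw [hsq]
    norm_num

/-- A null vector orthogonal to `ρ` is a multiple of `ρ`. -/
lemma eq_smul_ρ {v : Fin 26 → ℝ} (hv : B v ρ = 0) (h0 : B v v = 0) :
    v = (v (Fin.last 25) / 70) • ρ := by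
  have hsq := sum_sq_eq hv
  rw [h0, mul_zero, Finset.sum_eq_zero_iff_of_nonneg fun _ _ => sq_nonneg _] at hsq
  ext i
  refine Fin.lastCases ?_ (fun i => ?_) i
  · simp [ρ]
  · have := pow_eq_zero_iff (two_ne_zero) |>.1 (hsq i (Finset.mem_univ _))
    simp only [ρ, Pi.smul_apply, smul_eq_mul, Fin.val_castSucc, i.isLt, if_true]
    linarith

/-- The inner products of the simple roots labelled by the Leech lattice points form a
symmetrizable generalized Cartan datum (conditions (km1)–(km4)). -/
theorem leech_simple_roots_cartan_datum (r s : Fin 26 → ℝ)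
    (hr : r ∈ II) (hs : s ∈ II)
    (hrρ : B r ρ = -1) (hsρ : B s ρ = -1)
    (hr2 : B r r = 2) (hs2 : B s s = 2)
    (hrs : r ≠ s) :
    0 < B r r ∧ B r s = B s r ∧ (∃ k : ℤ, B r s = k) ∧ B r s ≤ 0 := by
  obtain ⟨n, hn⟩ := B_integral hr hs
  refine ⟨by rw [hr2]; norm_num, B_comm r s, ⟨n, hn⟩, ?_⟩
  have hv : B (r - s) ρ = 0 := by rw [B_sub_left, hrρ, hsρ, sub_self]
  have hvr : B (r - s) r = 2 - n := by rw [B_sub_left, hr2, B_comm s r, hn]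
  have hvs : B (r - s) s = n - 2 := by rw [B_sub_left, hs2, hn]
  have hvv : B (r - s) (r - s) = 4 - 2 * n := by
    rw [B_sub_left, B_comm r, B_comm s, hvr, hvs]
    ring
  have hnonneg : 0 ≤ 19600 * B (r - s) (r - s) :=
    sum_sq_eq hv ▸ Finset.sum_nonneg fun _ _ => sq_nonneg _
  have hn2 : n ≤ 2 := by
    have : (n : ℝ) ≤ 2 := by linarith
    exact_mod_cast this
  have hne1 : n ≠ 1 := by
    rintro rfl
    exact B_self_ne_two hr hs hv (by rw [hvv]; norm_num)
  have hne2 : n ≠ 2 := by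
    rintro rfl
    have h := eq_smul_ρ hv (by rw [hvv]; norm_num)
    set t := (r - s) (Fin.last 25) / 70
    have ht : t = 0 := by
      have hB : B (t • ρ) r = t * B r ρ := by
        simp only [B, Pi.smul_apply, smul_eq_mul, mul_sub, Finset.mul_sum]
        congr 1
        · exact Finset.sum_congr rfl fun _ _ => by ring
        · ring
      rw [← h, hvr, hrρ] at hB
      push_cast at hB
      linarith
    rw [ht, zero_smul, sub_eq_zero] at h
    exact hrs h
  have : n ≤ 0 := by omega
  rw [hn]
  exact_mod_cast this
end
end
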